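/- Let N ≥ 1. For every n ∈ ℕ, the n-th power of the generating operator G = X_1 of ℂ[F_N] has the representation G^n = Σ_{j=0}^{n} c(n,j)·X_j, where the coefficients c(n,j) are given by the recurrence of the recurrence diagram. (In the paper's notation, c(2k,2j) = p_{2j}^{2k} and c(2k−1,2j−1) = q_{2j−1}^{2k−1}.) -/

import Mathlib

/-- `X N n` is the sum, in the complex group algebra `ℂ[F_N]`, of all group elements
whose reduced word has length `n`. -/
noncomputable def X (N : ℕ) (n : ℕ) : MonoidAlgebra ℂ (FreeGroup (Fin N)) :=
  ∑ᶠ g ∈ {g : FreeGroup (Fin N) | g.norm = n}, MonoidAlgebra.of ℂ (FreeGroup (Fin N)) g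

/-- The coefficients of the recurrence diagram: `c N n j` is the coefficient of `X j`
in `G ^ n` (in the paper's notation, `c N (2k) (2j) = p_{2j}^{2k}` and
`c N (2k-1) (2j-1) = q_{2j-1}^{2k-1}`). -/
def c (N : ℕ) : ℕ → ℕ → ℕ
  | 0, 0 => 1
  | 0, _ + 1 => 0
  | n + 1, 0 => 2 * N * c N n 1
  | n + 1, 1 => c N n 0 + (2 * N - 1) * c N n 2
  | n + 1, j + 2 => c N n (j + 1) + (2 * N - 1) * c N n (j + 3)

open FreeGroup in
theorem finite_setOf_norm_eq {α : Type*} [Fintype α] [DecidableEq α] (n : ℕ) :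
    {g : FreeGroup α | g.norm = n}.Finite :=
  (List.finite_length_eq (α × Bool) n).preimage toWord_injective.injOn

theorem coeff_X (N n : ℕ) (g : FreeGroup (Fin N)) :
    (X N n).coeff g = if g.norm = n then 1 else 0 := by
  rw [X, finsum_mem_eq_finite_toFinset_sum _ (finite_setOf_norm_eq n)]
  simp [MonoidAlgebra.of_apply, Finsupp.finsetSum_apply, Finsupp.single_apply]

open FreeGroup in
theorem X_one_eq_sum (N : ℕ) :
    X N 1 = ∑ s : Fin N × Bool, MonoidAlgebra.single (mk [s]) 1 := by
  have hinj : Function.Injective fun s : Fin N × Bool => mk [s] := fun s t h => by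
    simpa using congrArg toWord h
  have himage : (finite_setOf_norm_eq (α := Fin N) 1).toFinset =
      Finset.univ.image fun s : Fin N × Bool => mk [s] := by
    ext g
    simp only [Set.Finite.mem_toFinset, Set.mem_ofPred_eq, Finset.mem_image, Finset.mem_univ,
      true_and]
    constructor
    · intro h
      obtain ⟨s, hs⟩ := List.length_eq_one_iff.mp h
      exact ⟨s, by rw [← hs, mk_toWord]⟩
    · rintro ⟨s, rfl⟩
      simp [FreeGroup.norm]
  rw [X, finsum_mem_eq_finite_toFinset_sum _ (finite_setOf_norm_eq 1), himage,
    Finset.sum_image hinj.injOn]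
  rfl

open FreeGroup in
theorem norm_mk_singleton_mul {α : Type*} [DecidableEq α] {g : FreeGroup α} {x : α × Bool}
    {L : List (α × Bool)} (hg : g.toWord = x :: L) (s : α × Bool) :
    (mk [s] * g).norm = if s = (x.1, !x.2) then L.length else L.length + 2 := by
  have hword : (mk [s] * g).toWord = reduce (s :: g.toWord) := by
    rw [toWord_mul, toWord_mk, reduce_singleton, List.singleton_append]
  rw [FreeGroup.norm, hword, reduce.cons, reduce_toWord, hg]
  simp only [Prod.ext_iff]
  split_ifs <;> simp

open FreeGroup in
/-- The sum of a radial function over the neighbours of `g` in the Cayley graph. -/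
theorem sum_norm_mk_singleton_mul (N : ℕ) (f : ℕ → ℕ) (g : FreeGroup (Fin N)) :
    ∑ s : Fin N × Bool, f (mk [s] * g).norm =
      if g.norm = 0 then 2 * N * f 1 else f (g.norm - 1) + (2 * N - 1) * f (g.norm + 1) := by
  rcases hg : g.toWord with _ | ⟨x, L⟩
  · obtain rfl : g = 1 := toWord_eq_nil_iff.mp hg
    simp [FreeGroup.norm, mul_comm]
  · have hnorm : g.norm = L.length + 1 := by simp [FreeGroup.norm, hg]
    simp only [norm_mk_singleton_mul hg, apply_ite f, hnorm]
    rw [Finset.sum_ite]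
    simp [Finset.filter_eq', Finset.filter_ne', mul_comm N 2]

open FreeGroup in
theorem c_succ_norm (N n : ℕ) (g : FreeGroup (Fin N)) :
    c N (n + 1) g.norm = ∑ s : Fin N × Bool, c N n (mk [s] * g).norm := by
  rw [sum_norm_mk_singleton_mul]
  rcases g.norm with _ | _ | j <;> simp [c]

theorem c_eq_zero_of_lt (N : ℕ) {n j : ℕ} (h : n < j) : c N n j = 0 := by
  induction n generalizing j with
  | zero => obtain ⟨j, rfl⟩ := Nat.exists_eq_succ_of_ne_zero h.ne'; simp [c]
  | succ n ih =>
    obtain ⟨j, rfl⟩ : ∃ k, j = k + 2 := ⟨j - 2, by omega⟩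
    rw [c, ih (by omega), ih (by omega), mul_zero, add_zero]

open FreeGroup in
theorem coeff_X_one_pow (N n : ℕ) (g : FreeGroup (Fin N)) :
    ((X N 1) ^ n).coeff g = c N n g.norm := by
  induction n generalizing g with
  | zero =>
    rcases eq_or_ne g 1 with rfl | hg
    · simp [MonoidAlgebra.one_def, c]
    · obtain ⟨k, hk⟩ := Nat.exists_eq_succ_of_ne_zero (mt norm_eq_zero.mp hg)
      simp [MonoidAlgebra.one_def, hg.symm, hk, c]
  | succ n ih =>
    have hinv (s : Fin N × Bool) : (mk [s])⁻¹ = mk [(s.1, !s.2)] := by simp [invRev]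
    rw [pow_succ', X_one_eq_sum, Finset.sum_mul, ← X_one_eq_sum, c_succ_norm]
    simp only [MonoidAlgebra.coeff_sum, Finsupp.finsetSum_apply,
      MonoidAlgebra.coeff_single_mul_apply, one_mul, ih, hinv, Nat.cast_sum]
    exact ((Equiv.refl (Fin N)).prodCongr Equiv.boolNot).sum_comp
      fun s => (c N n (mk [s] * g).norm : ℂ)

/-- `G^n = Σ_{j=0}^{n} c(n,j)·X_j`, where `G = X₁` is the generating operator of `ℂ[F_N]`. -/
theorem stmt3 (N : ℕ) (hN : 1 ≤ N) (n : ℕ) :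
    (X N 1) ^ n = ∑ j ∈ Finset.range (n + 1), (c N n j : ℂ) • X N j := by
  ext g
  rw [coeff_X_one_pow]
  simp only [MonoidAlgebra.coeff_sum, Finsupp.finsetSum_apply, MonoidAlgebra.coeff_smul_apply,
    coeff_X, smul_eq_mul, mul_ite, mul_one, mul_zero, Finset.sum_ite_eq, Finset.mem_range]
  split_ifs with h
  · rfl
  · rw [c_eq_zero_of_lt N (by omega), Nat.cast_zero]
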